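/- Let l > 0, ε ∈ {1, −1}, θ ∈ [0, 2π), and h₀, h₁ ∈ ℝ not both zero, and consider the separated PT-symmetric boundary conditions at ±l: h₀·ψ'(l) = h₁·e^{iθ}·ψ(l) and h₀·ψ'(−l) = −h₁·e^{−iθ}·ψ(−l). Then: (a) if h₀·h₁·sin θ ≠ 0, then for no λ ∈ ℂ does there exist a (επ/2, λ)-eigenfunction on (−l, l) satisfying these conditions at ±l; (b) if h₀·h₁·sin θ = 0 (in particular if θ = 0 or θ = π, in which case the separated conditions are symmetric Robin conditions), then for every λ ∈ ℂ such an eigenfunction exists. Hence the point spectrum of −d²/dx² on (−l,l) with point interaction φ = ±π/2 at the origin and separated PT-symmetric conditions at ±l is either empty or the entire complex plane. -/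

import Mathlib

open MeasureTheory Filter Topology

/-- A `(φ, λ)`-eigenfunction on `(-l, l)`: `ψ` (with derivative `dψ`) is not identically
zero, is twice continuously differentiable on `[-l, 0)` and on `(0, l]`, satisfies
`-ψ'' = λ ψ` there, its one-sided limits at `0` exist and satisfy the point-interaction
boundary conditions `ψ(0+) = e^{iφ} ψ(0-)`, `ψ'(0+) = e^{-iφ} ψ'(0-)`. -/
def IsEigenfun (l φr : ℝ) (lam : ℂ) (ψ dψ : ℝ → ℂ) : Prop :=
  (∃ x : ℝ, (x ∈ Set.Icc (-l) l ∧ x ≠ 0) ∧ ψ x ≠ 0) ∧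
  (∀ x ∈ Set.Ico (-l) (0:ℝ), HasDerivWithinAt ψ (dψ x) (Set.Ico (-l) 0) x) ∧
  (∀ x ∈ Set.Ico (-l) (0:ℝ), HasDerivWithinAt dψ (-lam * ψ x) (Set.Ico (-l) 0) x) ∧
  (∀ x ∈ Set.Ioc (0:ℝ) l, HasDerivWithinAt ψ (dψ x) (Set.Ioc 0 l) x) ∧
  (∀ x ∈ Set.Ioc (0:ℝ) l, HasDerivWithinAt dψ (-lam * ψ x) (Set.Ioc 0 l) x) ∧
  ∃ ψ0p ψ0m dψ0p dψ0m : ℂ,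
    Filter.Tendsto ψ (nhdsWithin 0 (Set.Ioi 0)) (nhds ψ0p) ∧
    Filter.Tendsto ψ (nhdsWithin 0 (Set.Iio 0)) (nhds ψ0m) ∧
    Filter.Tendsto dψ (nhdsWithin 0 (Set.Ioi 0)) (nhds dψ0p) ∧
    Filter.Tendsto dψ (nhdsWithin 0 (Set.Iio 0)) (nhds dψ0m) ∧
    ψ0p = Complex.exp (Complex.I * φr) * ψ0m ∧
    dψ0p = Complex.exp (-(Complex.I * φr)) * dψ0m

/-- The separated PT-symmetric boundary conditions at `±l`:
`h₀ ψ'(l) = h₁ e^{iθ} ψ(l)` and `h₀ ψ'(-l) = -h₁ e^{-iθ} ψ(-l)`. -/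
def SepBC (l h₀ h₁ θ : ℝ) (ψ dψ : ℝ → ℂ) : Prop :=
  (h₀ : ℂ) * dψ l = (h₁ : ℂ) * Complex.exp (Complex.I * θ) * ψ l ∧
  (h₀ : ℂ) * dψ (-l) = -(h₁ : ℂ) * Complex.exp (-(Complex.I * θ)) * ψ (-l)

/-- The cosine and sine type solutions of `-u'' = lam u`. -/
lemma exists_cos_sin_solutions (lam : ℂ) : ∃ C S : ℝ → ℂ,
    (∀ x, HasDerivAt C (-lam * S x) x) ∧ (∀ x, HasDerivAt S (C x) x) ∧
    C 0 = 1 ∧ S 0 = 0 ∧ ∀ x, C x ^ 2 + lam * S x ^ 2 = 1 := by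
  obtain ⟨k, rfl⟩ : ∃ k : ℂ, lam = k ^ 2 :=
    (IsAlgClosed.exists_pow_nat_eq lam two_pos).imp fun _ h => h.symm
  by_cases hk : k = 0
  · subst hk
    refine ⟨fun _ => 1, fun x => x, fun x => ?_, fun x => ?_, rfl, by simp, by simp⟩
    · simpa using hasDerivAt_const x (1 : ℂ)
    · exact (hasDerivAt_id x).ofReal_comp
  · have hlin : ∀ z : ℂ, HasDerivAt (fun y => k * y) k z := fun z => by
      simpa using (hasDerivAt_id z).const_mul k
    refine ⟨fun x => Complex.cos (k * x), fun x => Complex.sin (k * x) / k, fun x => ?_,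
      fun x => ?_, by simp, by simp, fun x => ?_⟩
    · exact (hlin x).ccos.comp_ofReal.congr_deriv (by field_simp)
    · exact ((hlin x).csin.div_const k).comp_ofReal.congr_deriv (by field_simp)
    · field_simp
      exact Complex.cos_sq_add_sin_sq _

/-- Every solution on `(0, l]` is a combination of the cosine and sine type solutions. -/
lemma exists_eq_combination {l : ℝ} (hl : 0 < l) {lam : ℂ} {C S u du : ℝ → ℂ}
    (hC : ∀ x, HasDerivAt C (-lam * S x) x) (hS : ∀ x, HasDerivAt S (C x) x)
    (hCS : ∀ x, C x ^ 2 + lam * S x ^ 2 = 1)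
    (hu : ∀ x ∈ Set.Ioc (0 : ℝ) l, HasDerivWithinAt u (du x) (Set.Ioc 0 l) x)
    (hdu : ∀ x ∈ Set.Ioc (0 : ℝ) l, HasDerivWithinAt du (-lam * u x) (Set.Ioc 0 l) x) :
    ∃ a b : ℂ, ∀ x ∈ Set.Ioc (0 : ℝ) l,
      u x = a * C x + b * S x ∧ du x = -lam * a * S x + b * C x := by
  have hconst : ∀ F : ℝ → ℂ, (∀ x ∈ Set.Ioc (0 : ℝ) l, HasDerivWithinAt F 0 (Set.Ioc 0 l) x) →
      ∀ x ∈ Set.Ioc (0 : ℝ) l, F x = F l := fun F hF x hx => by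
    have := (convex_Ioc (0 : ℝ) l).norm_image_sub_le_of_norm_hasDerivWithin_le
      (C := 0) hF (by simp) (Set.right_mem_Ioc.2 hl) hx
    simpa [sub_eq_zero] using this
  have ha := hconst (fun x => u x * C x - du x * S x) fun x hx => by
    exact (((hu x hx).mul (hC x).hasDerivWithinAt).sub
      ((hdu x hx).mul (hS x).hasDerivWithinAt)).congr_deriv (by ring)
  have hb := hconst (fun x => lam * (u x * S x) + du x * C x) fun x hx => by
    exact ((((hu x hx).mul (hS x).hasDerivWithinAt).const_mul lam).add
      ((hdu x hx).mul (hC x).hasDerivWithinAt)).congr_deriv (by ring)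
  refine ⟨u l * C l - du l * S l, lam * (u l * S l) + du l * C l, fun x hx => ⟨?_, ?_⟩⟩
  · rw [← ha x hx, ← hb x hx]
    linear_combination -u x * hCS x
  · rw [← ha x hx, ← hb x hx]
    linear_combination -du x * hCS x

/-- A solution on `(0, l]` with vanishing Cauchy data at `0+` is zero. -/
lemma eq_zero_of_tendsto_zero {l : ℝ} (hl : 0 < l) {lam : ℂ} {u du : ℝ → ℂ}
    (hu : ∀ x ∈ Set.Ioc (0 : ℝ) l, HasDerivWithinAt u (du x) (Set.Ioc 0 l) x)
    (hdu : ∀ x ∈ Set.Ioc (0 : ℝ) l, HasDerivWithinAt du (-lam * u x) (Set.Ioc 0 l) x)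
    (h0 : Tendsto u (𝓝[>] 0) (𝓝 0)) (h1 : Tendsto du (𝓝[>] 0) (𝓝 0)) :
    ∀ x ∈ Set.Ioc (0 : ℝ) l, u x = 0 ∧ du x = 0 := by
  obtain ⟨C, S, hC, hS, hC0, hS0, hCS⟩ := exists_cos_sin_solutions lam
  obtain ⟨a, b, hab⟩ := exists_eq_combination hl hC hS hCS hu hdu
  have cC : Tendsto C (𝓝[>] 0) (𝓝 1) := hC0 ▸ (hC 0).continuousAt.mono_left inf_le_left
  have cS : Tendsto S (𝓝[>] 0) (𝓝 0) := by
    have := (hS 0).continuousAt.tendsto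
    rw [hS0] at this
    exact this.mono_left inf_le_left
  have hev : ∀ᶠ x in 𝓝[>] (0 : ℝ), x ∈ Set.Ioc 0 l := Ioc_mem_nhdsGT hl
  have ha : a = 0 := by
    refine tendsto_nhds_unique ?_ h0
    have : Tendsto (fun x => a * C x + b * S x) (𝓝[>] 0) (𝓝 a) := by
      simpa using (cC.const_mul a).add (cS.const_mul b)
    exact this.congr' (hev.mono fun x hx => (hab x hx).1.symm)
  have hb : b = 0 := by
    refine tendsto_nhds_unique ?_ h1
    have : Tendsto (fun x => -lam * a * S x + b * C x) (𝓝[>] 0) (𝓝 b) := by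
      simpa using (cS.const_mul (-lam * a)).add (cC.const_mul b)
    exact this.congr' (hev.mono fun x hx => (hab x hx).2.symm)
  subst ha hb
  simpa using hab

/-- A solution on `(0, l]` with vanishing Cauchy data at `l` is zero. -/
lemma eq_zero_of_endpoint_eq_zero {l : ℝ} (hl : 0 < l) {lam : ℂ} {u du : ℝ → ℂ}
    (hu : ∀ x ∈ Set.Ioc (0 : ℝ) l, HasDerivWithinAt u (du x) (Set.Ioc 0 l) x)
    (hdu : ∀ x ∈ Set.Ioc (0 : ℝ) l, HasDerivWithinAt du (-lam * u x) (Set.Ioc 0 l) x)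
    (h0 : u l = 0) (h1 : du l = 0) : ∀ x ∈ Set.Ioc (0 : ℝ) l, u x = 0 := by
  obtain ⟨C, S, hC, hS, -, -, hCS⟩ := exists_cos_sin_solutions lam
  obtain ⟨a, b, hab⟩ := exists_eq_combination hl hC hS hCS hu hdu
  obtain ⟨e0, e1⟩ := hab l (Set.right_mem_Ioc.2 hl)
  rw [h0] at e0
  rw [h1] at e1
  have ha : a = 0 := by linear_combination -C l * e0 + S l * e1 - a * hCS l
  have hb : b = 0 := by linear_combination -lam * S l * e0 - C l * e1 - b * hCS l
  intro x hx
  simp [(hab x hx).1, ha, hb]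

/-- There is a global solution with prescribed Cauchy data at `l`. -/
lemma exists_solution_of_endpoint (l : ℝ) (lam A B : ℂ) : ∃ u du : ℝ → ℂ,
    (∀ x, HasDerivAt u (du x) x) ∧ (∀ x, HasDerivAt du (-lam * u x) x) ∧
    u l = A ∧ du l = B := by
  obtain ⟨C, S, hC, hS, hC0, hS0, -⟩ := exists_cos_sin_solutions lam
  have hC' := fun x => (hC (x - l)).comp_sub_const x l
  have hS' := fun x => (hS (x - l)).comp_sub_const x l
  refine ⟨fun x => A * C (x - l) + B * S (x - l), fun x => -lam * A * S (x - l) + B * C (x - l),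
    fun x => ?_, fun x => ?_, by simp [hC0, hS0], by simp [hC0, hS0]⟩
  · exact (((hC' x).const_mul A).add ((hS' x).const_mul B)).congr_deriv (by ring)
  · exact (((hS' x).const_mul (-lam * A)).add ((hC' x).const_mul B)).congr_deriv (by ring)

lemma exp_I_mul_sign_mul_pi_div_two {ε : ℝ} (hε : ε = 1 ∨ ε = -1) :
    Complex.exp (Complex.I * (ε * Real.pi / 2 : ℝ)) = ε * Complex.I := by
  rcases hε with rfl | rfl
  · simpa [mul_comm] using Complex.exp_pi_div_two_mul_I
  · simpa [mul_comm, neg_div] using Complex.exp_neg_pi_div_two_mul_I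

/-- Reflecting a function differentiable on `[-l, 0)` gives one differentiable on `(0, l]`. -/
lemma HasDerivWithinAt.comp_neg_Ioc {l x : ℝ} {f : ℝ → ℂ} {f' : ℂ}
    (hf : HasDerivWithinAt f f' (Set.Ico (-l) 0) (-x)) :
    HasDerivWithinAt (fun y => f (-y)) (-f') (Set.Ioc 0 l) x := by
  have hmaps : Set.MapsTo (fun y : ℝ => -y) (Set.Ioc 0 l) (Set.Ico (-l) 0) := fun y hy =>
    ⟨by linarith [hy.2], by linarith [hy.1]⟩
  exact (HasDerivWithinAt.scomp x hf (hasDerivAt_neg x).hasDerivWithinAt hmaps).congr_deriv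
    (by simp)

/-- If `c² = -1`, the interaction `ψ(0+) = c ψ(0-)`, `ψ'(0+) = -c ψ'(0-)` forces
`ψ(x) = c ψ(-x)` and `ψ'(x) = -c ψ'(-x)` on all of `(0, l]`. -/
lemma IsEigenfun.reflection {l φr : ℝ} (hl : 0 < l) {lam c : ℂ} {ψ dψ : ℝ → ℂ}
    (hc : Complex.exp (Complex.I * φr) = c) (hc' : Complex.exp (-(Complex.I * φr)) = -c)
    (h : IsEigenfun l φr lam ψ dψ) :
    ∀ x ∈ Set.Ioc (0 : ℝ) l, ψ x = c * ψ (-x) ∧ dψ x = -c * dψ (-x) := by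
  obtain ⟨-, hm, hdm, hp, hdp, a, b, a', b', ta, tb, ta', tb', hab, hab'⟩ := h
  rw [hc] at hab
  rw [hc'] at hab'
  have hneg : Tendsto (fun x : ℝ => -x) (𝓝[>] 0) (𝓝[<] 0) := by
    simpa using tendsto_neg_nhdsGT (a := (0 : ℝ))
  have hmem : ∀ x ∈ Set.Ioc (0 : ℝ) l, -x ∈ Set.Ico (-l) 0 := fun x hx =>
    ⟨by linarith [hx.2], by linarith [hx.1]⟩
  have key := eq_zero_of_tendsto_zero hl (lam := lam) (u := fun x => ψ x - c * ψ (-x))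
    (du := fun x => dψ x + c * dψ (-x))
    (fun x hx => ((hp x hx).sub
      ((hm (-x) (hmem x hx)).comp_neg_Ioc.const_mul c)).congr_deriv (by ring))
    (fun x hx => ((hdp x hx).add
      ((hdm (-x) (hmem x hx)).comp_neg_Ioc.const_mul c)).congr_deriv (by ring))
    (by simpa [hab] using ta.sub ((tb.comp hneg).const_mul c))
    (by simpa [hab'] using ta'.add ((tb'.comp hneg).const_mul c))
  intro x hx
  obtain ⟨h0, h1⟩ := key x hx
  exact ⟨by linear_combination h0, by linear_combination h1⟩

/-- If `c² = -1`, a nontrivial solution on the line extends by reflection to an eigenfunction. -/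
lemma isEigenfun_reflect {l φr : ℝ} (hl : 0 < l) {lam c : ℂ} {u du : ℝ → ℂ}
    (hc : Complex.exp (Complex.I * φr) = c) (hc' : Complex.exp (-(Complex.I * φr)) = -c)
    (hcc : c ^ 2 = -1)
    (hu : ∀ x, HasDerivAt u (du x) x) (hdu : ∀ x, HasDerivAt du (-lam * u x) x)
    (hne : ¬(u l = 0 ∧ du l = 0)) :
    IsEigenfun l φr lam (fun x => if 0 < x then u x else -c * u (-x))
      (fun x => if 0 < x then du x else c * du (-x)) := by
  have hneg : ∀ {f : ℝ → ℂ} {f' : ℝ → ℂ}, (∀ x, HasDerivAt f (f' x) x) → ∀ x,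
      HasDerivAt (fun y => f (-y)) (-f' (-x)) x := fun hf x =>
    ((hf (-x)).scomp x (hasDerivAt_neg x)).congr_deriv (by simp)
  have hr := fun x => (hneg hu x).const_mul (-c)
  have hdr := fun x => (hneg hdu x).const_mul c
  have hnonpos : ∀ {a b : ℂ} {x : ℝ}, x < 0 → (if 0 < x then a else b) = b :=
    fun hx => if_neg hx.not_gt
  have limR : ∀ {f : ℝ → ℂ} (g : ℝ → ℂ), ContinuousAt f 0 →
      Tendsto (fun x => if 0 < x then f x else g x) (𝓝[>] 0) (𝓝 (f 0)) := fun g hf =>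
    (hf.tendsto.mono_left inf_le_left).congr'
      (eventually_nhdsWithin_of_forall fun x hx => (if_pos hx).symm)
  have limL : ∀ (f : ℝ → ℂ) {g : ℝ → ℂ}, ContinuousAt g 0 →
      Tendsto (fun x => if 0 < x then f x else g x) (𝓝[<] 0) (𝓝 (g 0)) := fun f _ hg =>
    (hg.tendsto.mono_left inf_le_left).congr'
      (eventually_nhdsWithin_of_forall fun x hx => (hnonpos hx).symm)
  refine ⟨?_, fun x hx => ?_, fun x hx => ?_, fun x hx => ?_, fun x hx => ?_,
    u 0, -c * u (-0), du 0, c * du (-0), limR _ (hu 0).continuousAt,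
    limL _ (hr 0).continuousAt, limR _ (hdu 0).continuousAt, limL _ (hdr 0).continuousAt, ?_, ?_⟩
  · by_contra! hzero
    have hz : ∀ x ∈ Set.Ioc (0 : ℝ) l, u x = 0 := fun x hx => by
      simpa [hx.1] using hzero x ⟨⟨by linarith [hx.1], hx.2⟩, hx.1.ne'⟩
    have hlmem : l ∈ Set.Ioc (0 : ℝ) l := Set.right_mem_Ioc.2 hl
    refine hne ⟨hz l hlmem, ?_⟩
    exact (uniqueDiffOn_Ioc (0 : ℝ) l l hlmem).eq_deriv _ (hu l).hasDerivWithinAt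
      ((hasDerivWithinAt_const l _ (0 : ℂ)).congr hz (hz l hlmem))
  · beta_reduce
    rw [hnonpos hx.2]
    exact ((hr x).hasDerivWithinAt.congr_deriv (by ring)).congr
      (fun y hy => hnonpos hy.2) (hnonpos hx.2)
  · beta_reduce
    rw [hnonpos hx.2]
    exact ((hdr x).hasDerivWithinAt.congr_deriv (by ring)).congr
      (fun y hy => hnonpos hy.2) (hnonpos hx.2)
  · beta_reduce
    rw [if_pos hx.1]
    exact (hu x).hasDerivWithinAt.congr (fun y hy => if_pos hy.1) (if_pos hx.1)
  · beta_reduce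
    rw [if_pos hx.1]
    exact (hdu x).hasDerivWithinAt.congr (fun y hy => if_pos hy.1) (if_pos hx.1)
  · rw [hc, neg_zero]
    linear_combination u 0 * hcc
  · rw [hc', neg_zero]
    linear_combination du 0 * hcc

/-- The two conjugate phases differ by `2i sin θ`. -/
lemma exp_I_mul_sub_exp_neg (θ : ℝ) :
    Complex.exp (Complex.I * θ) - Complex.exp (-(Complex.I * θ))
      = 2 * Complex.I * (Real.sin θ : ℂ) := by
  rw [mul_comm Complex.I, ← neg_mul, Complex.exp_mul_I, Complex.exp_mul_I, Complex.cos_neg,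
    Complex.sin_neg, Complex.ofReal_sin]
  ring

/-- for the point interaction `φ = επ/2` at the origin with separated
PT-symmetric boundary conditions at `±l`: (a) if `h₀h₁ sin θ ≠ 0` there is no
`(επ/2, λ)`-eigenfunction for any `λ ∈ ℂ`; (b) if `h₀h₁ sin θ = 0` (in particular for
`θ = 0, π`, i.e. symmetric Robin conditions) every `λ ∈ ℂ` admits one. Hence the point
spectrum is either empty or the entire complex plane. -/
theorem surprising_spectra_stmt19
    (l : ℝ) (hl : 0 < l) (ε : ℝ) (hε : ε = 1 ∨ ε = -1)
    (θ : ℝ) (hθ : θ ∈ Set.Ico 0 (2 * Real.pi))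
    (h₀ h₁ : ℝ) (hh : ¬ (h₀ = 0 ∧ h₁ = 0)) :
    -- (a)
    (h₀ * h₁ * Real.sin θ ≠ 0 →
      ∀ lam : ℂ, ¬ ∃ ψ dψ : ℝ → ℂ,
        IsEigenfun l (ε * Real.pi / 2) lam ψ dψ ∧ SepBC l h₀ h₁ θ ψ dψ) ∧
    -- (b)
    (h₀ * h₁ * Real.sin θ = 0 →
      ∀ lam : ℂ, ∃ ψ dψ : ℝ → ℂ,
        IsEigenfun l (ε * Real.pi / 2) lam ψ dψ ∧ SepBC l h₀ h₁ θ ψ dψ) := by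
  have hc := exp_I_mul_sign_mul_pi_div_two hε
  have hcc : ((ε : ℂ) * Complex.I) ^ 2 = -1 := by
    rcases hε with rfl | rfl <;> simp
  have hc' : Complex.exp (-(Complex.I * (ε * Real.pi / 2 : ℝ))) = -(ε * Complex.I) := by
    rw [Complex.exp_neg, hc]
    exact inv_eq_of_mul_eq_one_right (by linear_combination -hcc)
  generalize (ε : ℂ) * Complex.I = c at hc hc' hcc
  have hsin := exp_I_mul_sub_exp_neg θ
  constructor
  · rintro hne lam ⟨ψ, dψ, hψ, hbr, hbl⟩
    have hrefl := hψ.reflection hl hc hc'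
    obtain ⟨hl0, hl1⟩ := hrefl l (Set.right_mem_Ioc.2 hl)
    have hne' : (h₀ : ℂ) ≠ 0 ∧ (h₁ : ℂ) * (2 * Complex.I * (Real.sin θ : ℂ)) ≠ 0 := by
      simp only [ne_eq, mul_eq_zero, not_or] at hne
      simp only [ne_eq, mul_eq_zero, Complex.ofReal_eq_zero, not_or]
      exact ⟨hne.1.1, hne.1.2, ⟨two_ne_zero, Complex.I_ne_zero⟩, hne.2⟩
    have hψl : ψ l = 0 := by
      refine (mul_eq_zero.1 ?_).resolve_left hne'.2
      rw [← hsin]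
      linear_combination -hbr + h₀ * hl1 - c * hbl
        - h₁ * Complex.exp (-(Complex.I * θ)) * hl0
    have hdψl : dψ l = 0 := (mul_eq_zero.1 (by rw [hbr, hψl, mul_zero])).resolve_left hne'.1
    obtain ⟨⟨x, ⟨hx, hx0⟩, hψx⟩, -, -, hp, hdp, -⟩ := hψ
    have hzero := eq_zero_of_endpoint_eq_zero hl hp hdp hψl hdψl
    rcases lt_or_gt_of_ne hx0 with hneg | hpos
    · have hmem : -x ∈ Set.Ioc (0 : ℝ) l := ⟨by linarith, by linarith [hx.1]⟩
      have h := (hrefl (-x) hmem).1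
      rw [hzero (-x) hmem, neg_neg] at h
      exact hψx (by linear_combination ψ x * hcc + c * h)
    · exact hψx (hzero x ⟨hpos, hx.2⟩)
  · intro h0 lam
    obtain ⟨u, du, hu, hdu, hul, hdul⟩ :=
      exists_solution_of_endpoint l lam h₀ (h₁ * Complex.exp (Complex.I * θ))
    have h0' : (h₀ : ℂ) * h₁ * (Real.sin θ : ℂ) = 0 := by exact_mod_cast h0
    refine ⟨_, _, isEigenfun_reflect hl hc hc' hcc hu hdu ?_, ?_, ?_⟩
    · simpa [hul, hdul] using hh
    · simp only [hl, if_true, hul, hdul]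
      ring
    · have hnl : ¬ 0 < -l := by linarith
      simp only [hnl, if_false, neg_neg, hul, hdul]
      linear_combination (h₀ * h₁ * c) * hsin + 2 * Complex.I * c * h0'
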